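/- For all α = (α_1,…,α_d) ∈ (0,1)^d, t ∈ ℝ_+^d and every real u with |u| ≤ 1, the multiparameter fractional GCP distribution has probability generating function Σ_{n=0}^∞ p_α(n,t) u^n = ∏_{i=1}^d E_{α_i,1}(−t_i^{α_i} Σ_{j=1}^k λ_{ji}(1 − u^j)). -/

import Mathlib

open scoped BigOperators

/-- The three-parameter Mittag-Leffler function
`E^γ_{α,β}(x) = Σ_{r=0}^∞ Γ(r+γ) x^r / (Γ(γ) r! Γ(rα+β))`. -/
noncomputable def ml3 (a b c x : ℝ) : ℝ :=
  ∑' r : ℕ, Real.Gamma (r + c) * x ^ r /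
    (Real.Gamma c * (Nat.factorial r) * Real.Gamma (r * a + b))

/-- The distribution of the multiparameter fractional GCP:
`p_α(n,t) = Σ_{(n_1,…,n_k) ∈ Ω(k,n)} Σ_{(n_{j1},…,n_{jd}) ∈ Θ(n_j,d), j = 1,…,k}
  ∏_i (Σ_j n_{ji})! (∏_j (λ_{ji} t_i^{α_i})^{n_{ji}}/n_{ji}!)
       E^{Σ_j n_{ji}+1}_{α_i, α_i Σ_j n_{ji}+1}(−t_i^{α_i} Σ_j λ_{ji})`. -/
noncomputable def pFrac (d k : ℕ) (lam : Fin k → Fin d → ℝ) (alpha : Fin d → ℝ)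
    (n : ℕ) (t : Fin d → ℝ) : ℝ :=
  ∑' y : Fin k → ℕ,
    if (∑ j, (j.1 + 1) * y j) = n then
      ∑' m : Fin k → Fin d → ℕ,
        if (∀ j, (∑ i, m j i) = y j) then
          ∏ i, ((Nat.factorial (∑ j, m j i) : ℝ) *
            (∏ j, (lam j i * t i ^ alpha i) ^ (m j i) / (Nat.factorial (m j i))) *
            ml3 (alpha i) (alpha i * (∑ j, m j i) + 1) ((∑ j, m j i) + 1)
              (-(t i ^ alpha i) * ∑ j, lam j i))
        else 0
    else 0

open MeasureTheory Set in
/-- Tail bound `Γ(s+1) ≥ e^{-Y} Y^s`. -/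
lemma exp_neg_mul_rpow_le_Gamma {s Y : ℝ} (hs : 0 ≤ s) (hY : 0 ≤ Y) :
    Real.exp (-Y) * Y ^ s ≤ Real.Gamma (s + 1) := by
  have hc := Real.GammaIntegral_convergent (s := s + 1) (by linarith)
  rw [Real.Gamma_eq_integral (by linarith)]
  simp only [add_sub_cancel_right] at hc ⊢
  calc Real.exp (-Y) * Y ^ s = ∫ x in Ioi Y, Real.exp (-x) * Y ^ s := by
        rw [integral_mul_const, integral_exp_neg_Ioi]
    _ ≤ ∫ x in Ioi Y, Real.exp (-x) * x ^ s := by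
        refine setIntegral_mono_on ((integrableOn_exp_neg_Ioi Y).mul_const _)
          (hc.mono_set (Ioi_subset_Ioi hY)) measurableSet_Ioi fun x hx => ?_
        have hx : Y < x := hx
        gcongr
    _ ≤ ∫ x in Ioi 0, Real.exp (-x) * x ^ s := by
        refine setIntegral_mono_set hc ?_ (Ioi_subset_Ioi hY).eventuallyLE
        filter_upwards [ae_restrict_mem measurableSet_Ioi] with x hx
        have hx : 0 < x := hx
        positivity

lemma summable_pow_div_Gamma {a : ℝ} (ha : 0 < a) {x : ℝ} (hx : 0 ≤ x) :
    Summable fun n : ℕ => |(Real.Gamma (n * a + 1))⁻¹| * x ^ n := by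
  set Y : ℝ := (2 * x + 1) ^ a⁻¹ with hY
  have hYpos : 0 < Y := by positivity
  refine Summable.of_nonneg_of_le (fun n => by positivity) (fun n => ?_)
    (summable_geometric_two.mul_left (Real.exp Y))
  have hpow : Y ^ (n * a) = (2 * x + 1) ^ n := by
    rw [hY, ← Real.rpow_mul (by positivity), ← Real.rpow_natCast]
    congr 1
    field_simp
  have hG := exp_neg_mul_rpow_le_Gamma (s := n * a) (by positivity) hYpos.le
  rw [hpow] at hG
  rw [abs_of_nonneg (by positivity), inv_mul_le_iff₀ (by positivity)]
  calc x ^ n = Real.exp (-Y) * (2 * x) ^ n * (Real.exp Y * (1 / 2) ^ n) := by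
        rw [mul_pow, div_pow, one_pow, Real.exp_neg]
        field_simp
    _ ≤ Real.exp (-Y) * (2 * x + 1) ^ n * (Real.exp Y * (1 / 2) ^ n) := by
        gcongr
        linarith
    _ ≤ _ := by gcongr

lemma hasSum_multinomial {ι : Type*} [Fintype ι] [DecidableEq ι] (b : ι → ℝ) (w : ℕ → ℝ)
    (hw : Summable fun n => |w n| * (∑ i, |b i|) ^ n) :
    HasSum (fun v : ι → ℕ => w (∑ i, v i) *
      (Nat.multinomial Finset.univ v * ∏ i, b i ^ v i)) (∑' n, w n * (∑ i, b i) ^ n) := by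
  have hset : ∀ n : ℕ, (fun v : ι → ℕ => ∑ i, v i) ⁻¹' {n} =
      ↑(Finset.piAntidiag (Finset.univ : Finset ι) n) := by
    intro n; ext v; simp
  have hfib : ∀ (w : ℕ → ℝ) (b : ι → ℝ) (n : ℕ),
      ∑' v : ((fun v : ι → ℕ => ∑ i, v i) ⁻¹' {n}), w (∑ i, v.1 i) *
        (Nat.multinomial Finset.univ v.1 * ∏ i, b i ^ v.1 i) = w n * (∑ i, b i) ^ n := by
    intro w b n
    rw [hset]
    refine (Finset.tsum_subtype (Finset.piAntidiag Finset.univ n) (fun v : ι → ℕ =>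
      w (∑ i, v i) * ((Nat.multinomial Finset.univ v : ℝ) * ∏ i, b i ^ v i))).trans ?_
    rw [Finset.sum_pow_eq_sum_piAntidiag, Finset.mul_sum]
    refine Finset.sum_congr rfl fun v hv => ?_
    rw [(Finset.mem_piAntidiag.1 hv).1]
  have hsum : Summable (fun v : ι → ℕ => w (∑ i, v i) *
      (Nat.multinomial Finset.univ v * ∏ i, b i ^ v i)) := by
    rw [← summable_abs_iff]
    have habs : (fun v : ι → ℕ => |w (∑ i, v i) *
        (Nat.multinomial Finset.univ v * ∏ i, b i ^ v i)|) = fun v : ι → ℕ =>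
        |w (∑ i, v i)| * (Nat.multinomial Finset.univ v * ∏ i, |b i| ^ v i) := by
      ext v
      simp [abs_mul, Finset.abs_prod]
    rw [habs, summable_partition (s := fun n => (fun v : ι → ℕ => ∑ i, v i) ⁻¹' {n})
      (fun v => by dsimp only [Pi.zero_apply]; positivity)
      (fun v => ⟨∑ i, v i, rfl, fun n hn => Eq.symm hn⟩)]
    refine ⟨fun n => ?_, ?_⟩
    · have : Finite ↑((fun v : ι → ℕ => ∑ i, v i) ⁻¹' {n}) := by
        rw [hset]; exact Finset.finite_toSet _
      exact Summable.of_finite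
    · exact hw.congr fun n => (hfib (fun n => |w n|) (fun i => |b i|) n).symm
  have h := hsum.hasSum.tsum_fiberwise (fun v : ι → ℕ => ∑ i, v i)
  rw [← funext (hfib w b), h.tsum_eq]
  exact hsum.hasSum

lemma ml3_one_one (a x : ℝ) :
    ml3 a 1 1 x = ∑' n : ℕ, (Real.Gamma (n * a + 1))⁻¹ * x ^ n := by
  refine tsum_congr fun n => ?_
  rw [Real.Gamma_nat_eq_factorial, Real.Gamma_one]
  field_simp

/-- Multinomial addition formula for the Mittag-Leffler function. -/
lemma hasSum_ml3_multinomial {k : ℕ} {a : ℝ} (ha : 0 < a) (c : Fin k → ℝ) (x : ℝ) :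
    HasSum (fun v : Fin k → ℕ => ((∑ j, v j).factorial : ℝ) *
      (∏ j, c j ^ v j / (v j).factorial) *
      ml3 a (a * (∑ j, v j : ℕ) + 1) ((∑ j, v j : ℕ) + 1) x)
      (ml3 a 1 1 (∑ j, c j + x)) := by
  have h := hasSum_multinomial (Fin.cons x c : Fin (k + 1) → ℝ)
    (fun n => (Real.Gamma (n * a + 1))⁻¹) (summable_pow_div_Gamma ha (by positivity))
  rw [Fin.sum_univ_succ (Fin.cons x c : Fin (k + 1) → ℝ)] at h
  simp only [Fin.cons_zero, Fin.cons_succ] at h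
  rw [ml3_one_one a, add_comm]
  rw [← ((Equiv.prodComm _ _).trans (Fin.consEquiv fun _ : Fin (k + 1) => ℕ)).hasSum_iff] at h
  refine h.prod_fiberwise fun v => ?_
  have hs := h.summable.prod_factor v
  refine hs.hasSum_iff.2 (Eq.symm ?_)
  simp only [ml3]
  rw [← tsum_mul_left]
  refine tsum_congr fun r => ?_
  have hm := Nat.multinomial_spec Finset.univ (Fin.cons r v : Fin (k + 1) → ℕ)
  simp only [Fin.prod_univ_succ, Fin.sum_univ_succ, Fin.cons_zero, Fin.cons_succ] at hm
  have hm' : (r.factorial * ∏ j, (v j).factorial : ℝ) *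
      Nat.multinomial Finset.univ (Fin.cons r v : Fin (k + 1) → ℕ) =
      (r + ∑ j, v j).factorial := by exact_mod_cast hm
  have hp : (∏ j, ((v j).factorial : ℝ)) ≠ 0 := by positivity
  have he : (Fin.consEquiv fun _ : Fin (k + 1) => ℕ) (r, v) = Fin.cons r v := rfl
  simp only [Function.comp, Equiv.trans_apply, Equiv.prodComm_apply, Prod.swap,
    he, Fin.prod_univ_succ, Fin.sum_univ_succ, Fin.cons_zero, Fin.cons_succ,
    Finset.prod_div_distrib]
  generalize (∑ j, v j) = S at *
  have e1 : Real.Gamma (r + ((S : ℝ) + 1)) = (r + S).factorial := by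
    rw [← Real.Gamma_nat_eq_factorial]; push_cast; ring_nf
  have e2 : (r : ℝ) * a + (a * S + 1) = ((r + S : ℕ) : ℝ) * a + 1 := by push_cast; ring
  rw [e1, e2, Real.Gamma_nat_eq_factorial, ← hm']
  push_cast
  field_simp

lemma hasSum_pi_prod {X : Type*} : ∀ {d : ℕ} (f : Fin d → X → ℝ) (s : Fin d → ℝ),
    (∀ i, HasSum (f i) (s i)) → HasSum (fun m : Fin d → X => ∏ i, f i (m i)) (∏ i, s i)
  | 0, f, s, _ => by
    simp [hasSum_unique]
  | d + 1, f, s, h => by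
    have ih := hasSum_pi_prod (fun i => f i.succ) (fun i => s i.succ) fun i => h i.succ
    rw [← (Fin.consEquiv fun _ : Fin (d + 1) => X).hasSum_iff, Fin.prod_univ_succ]
    have hs := summable_mul_of_summable_norm (h 0).summable.norm ih.summable.norm
    refine ((h 0).mul ih hs).congr_fun fun p => ?_
    simp [Fin.prod_univ_succ]

lemma hasSum_tsum_ite {X Y : Type*} [DecidableEq Y] {f : X → ℝ} {s : ℝ} (h : HasSum f s)
    (g : X → Y) : HasSum (fun y => ∑' x, if g x = y then f x else 0) s := by
  refine (h.tsum_fiberwise g).congr_fun fun y => ?_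
  refine Eq.trans (tsum_congr fun x => ?_) (tsum_subtype (g ⁻¹' {y}) f).symm
  simp [Set.indicator]

/-- For all `α ∈ (0,1)^d`, `t ∈ ℝ_+^d` and every real `u` with `|u| ≤ 1`, the multiparameter
fractional GCP distribution has probability generating function
`Σ_{n=0}^∞ p_α(n,t) u^n = ∏_{i=1}^d E_{α_i,1}(−t_i^{α_i} Σ_{j=1}^k λ_{ji}(1 − u^j))`. -/
theorem pFrac_pgf (d k : ℕ) (hd : 1 ≤ d) (hk : 1 ≤ k)
    (lam : Fin k → Fin d → ℝ) (hlam : ∀ j i, 0 < lam j i)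
    (alpha : Fin d → ℝ) (halpha : ∀ i, alpha i ∈ Set.Ioo (0 : ℝ) 1)
    (t : Fin d → ℝ) (ht : ∀ i, 0 ≤ t i) (u : ℝ) (hu : |u| ≤ 1) :
    ∑' n : ℕ, pFrac d k lam alpha n t * u ^ n
      = ∏ i, ml3 (alpha i) 1 1 (-(t i ^ alpha i) * ∑ j : Fin k, lam j i * (1 - u ^ (j.1 + 1))) := by
  classical
  set F : (Fin k → Fin d → ℕ) → ℝ := fun m =>
    ∏ i, ((Nat.factorial (∑ j, m j i) : ℝ) *
      (∏ j, (lam j i * t i ^ alpha i) ^ (m j i) / (Nat.factorial (m j i))) *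
      ml3 (alpha i) (alpha i * (∑ j, m j i) + 1) ((∑ j, m j i) + 1)
        (-(t i ^ alpha i) * ∑ j, lam j i)) with hF
  have hmain := hasSum_pi_prod _ _ fun i =>
    hasSum_ml3_multinomial (halpha i).1 (fun j => lam j i * t i ^ alpha i * u ^ (j.1 + 1))
      (-(t i ^ alpha i) * ∑ j, lam j i)
  have harg : ∀ i, ∑ j : Fin k, lam j i * t i ^ alpha i * u ^ (j.1 + 1) +
      -(t i ^ alpha i) * ∑ j, lam j i =
      -(t i ^ alpha i) * ∑ j : Fin k, lam j i * (1 - u ^ (j.1 + 1)) := fun i => by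
    simp only [mul_sub, mul_one, Finset.sum_sub_distrib, Finset.mul_sum, neg_mul,
      Finset.sum_neg_distrib]
    rw [sub_neg_eq_add, add_comm]
    congr 1
    exact Finset.sum_congr rfl fun j _ => by ring
  simp only [harg] at hmain
  rw [← (Equiv.piComm fun (_ : Fin k) (_ : Fin d) => ℕ).hasSum_iff] at hmain
  have hterm : HasSum (fun m => F m * u ^ (∑ j : Fin k, (j.1 + 1) * ∑ i, m j i))
      (∏ i, ml3 (alpha i) 1 1
        (-(t i ^ alpha i) * ∑ j : Fin k, lam j i * (1 - u ^ (j.1 + 1)))) := by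
    convert hmain using 1
    ext m
    have hu' : u ^ (∑ j : Fin k, (j.1 + 1) * ∑ i, m j i) =
        ∏ i, ∏ j : Fin k, (u ^ (j.1 + 1)) ^ m j i := by
      rw [Finset.prod_comm, ← Finset.prod_pow_eq_pow_sum]
      refine Finset.prod_congr rfl fun j _ => ?_
      rw [pow_mul, Finset.prod_pow_eq_pow_sum]
    rw [hu', hF, ← Finset.prod_mul_distrib]
    refine Finset.prod_congr rfl fun i _ => ?_
    simp only [Equiv.piComm_apply, Function.swap, mul_pow (_ * _) (u ^ _),
      mul_div_right_comm _ (_ ^ _) _, Finset.prod_mul_distrib]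
    push_cast
    ring
  have hgroup := hasSum_tsum_ite (hasSum_tsum_ite hterm fun m j => ∑ i, m j i)
    fun y : Fin k → ℕ => ∑ j, (j.1 + 1) * y j
  rw [← hgroup.tsum_eq]
  refine tsum_congr fun n => ?_
  rw [pFrac, ← tsum_mul_right]
  refine tsum_congr fun y => ?_
  rw [ite_mul, zero_mul]
  split_ifs with hn
  swap
  · rfl
  rw [← tsum_mul_right]
  refine tsum_congr fun m => ?_
  rw [ite_mul, zero_mul]
  by_cases hm : ∀ j, ∑ i, m j i = y j
  · rw [if_pos hm, if_pos (funext hm)]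
    simp only [hm, hn, hF]
  · rw [if_neg hm, if_neg fun h => hm (congrFun h)]
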